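/- arXiv:1611.03847 — 10 statements merged into one kernel-verified Lean document; each statement's English description precedes it below -/
import Mathlib

section
/- There exists a 10×10 integer matrix M such that M·G₀·Mᵀ equals the block-diagonal matrix diag(6) ⊕ (−C), where C is the block Cartan matrix of E₇ ⊕ A₂. Equivalently, the rank-10 lattice ℤH ⊥ (E₇ + A₂) with H² = 6 and E₇ + A₂ negative definite embeds as a finite-index sublattice (necessarily of index 6) into the even unimodular lattice U + E₈ of signature (1,9). (This realizes the gluing data for the root type A₅ + 2A₂ with primitive closure E₇ + A₂.) -/
open Matrix

/-- The Cartan matrix of the root lattice `Aₙ`: vertices `0, …, n-1` in a chain. -/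
def cartanA (n : ℕ) : Matrix (Fin n) (Fin n) ℤ :=
  Matrix.of fun i j =>
    if i = j then 2
    else if (i : ℕ) + 1 = (j : ℕ) ∨ (j : ℕ) + 1 = (i : ℕ) then -1
    else 0

/-- The Cartan matrix of the root lattice `Dₙ` (`n ≥ 4`): a chain `0 — 1 — ⋯ — (n-3)`
with the two extra vertices `n-2` and `n-1` both attached to the vertex `n-3`. -/
def cartanD (n : ℕ) : Matrix (Fin n) (Fin n) ℤ :=
  Matrix.of fun i j =>
    if i = j then 2
    else if ((((i : ℕ) + 1 = (j : ℕ) ∨ (j : ℕ) + 1 = (i : ℕ)) ∧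
          ¬ (((i : ℕ) = n - 2 ∧ (j : ℕ) = n - 1) ∨ ((j : ℕ) = n - 2 ∧ (i : ℕ) = n - 1))) ∨
        (((i : ℕ) = n - 3 ∧ (j : ℕ) = n - 1) ∨ ((j : ℕ) = n - 3 ∧ (i : ℕ) = n - 1))) then -1
    else 0

/-- The Cartan matrix of the root lattice `Eₙ` (`n = 6, 7, 8`): a chain `1 — 2 — ⋯ — (n-1)`
with the extra vertex `0` attached to the vertex `3`. -/
def cartanE (n : ℕ) : Matrix (Fin n) (Fin n) ℤ :=
  Matrix.of fun i j =>
    if i = j then 2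
    else if ((((i : ℕ) + 1 = (j : ℕ) ∨ (j : ℕ) + 1 = (i : ℕ)) ∧
          ¬ ((i : ℕ) = 0 ∨ (j : ℕ) = 0)) ∨
        (((i : ℕ) = 0 ∧ (j : ℕ) = 3) ∨ ((j : ℕ) = 0 ∧ (i : ℕ) = 3))) then -1
    else 0

/-- The block-diagonal sum `A ⊕ B` of two square integer matrices. -/
def blockSum {m n : ℕ} (A : Matrix (Fin m) (Fin m) ℤ) (B : Matrix (Fin n) (Fin n) ℤ) :
    Matrix (Fin (m + n)) (Fin (m + n)) ℤ :=
  Matrix.of fun i j =>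
    if hi : (i : ℕ) < m then
      if hj : (j : ℕ) < m then A ⟨i, hi⟩ ⟨j, hj⟩ else 0
    else
      if hj : (j : ℕ) < m then 0
      else B ⟨(i : ℕ) - m, by have := i.isLt; omega⟩ ⟨(j : ℕ) - m, by have := j.isLt; omega⟩

/-- The Gram matrix of the hyperbolic plane `U`. -/
def gramU : Matrix (Fin 2) (Fin 2) ℤ := !![0, 1; 1, 0]

/-- The Gram matrix `G₀` of the even unimodular lattice `U + E₈` of signature `(1,9)`. -/
def gramUE8 : Matrix (Fin 10) (Fin 10) ℤ := blockSum gramU (-(cartanE 8))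

/-- The lattice `ℤH ⊥ (E₇ + A₂)` with `H² = 6` embeds with finite index into `U + E₈`. -/
theorem embedding_H6_E7_A2 :
    ∃ M : Matrix (Fin 10) (Fin 10) ℤ,
      M * gramUE8 * M.transpose =
        blockSum !![(6 : ℤ)] (-(blockSum (cartanE 7) (cartanA 2))) := by
  -- `E₇ ⊂ E₈` is spanned by the first seven simple roots; its orthogonal complement in
  -- `U + E₈` is `U + ℤθ` with `θ` the highest root of `E₈`, and contains `A₂` and `H`.
  refine ⟨!![2, 2, 3, 2, 4, 6, 5, 4, 3, 2;
       0, 0, 1, 0, 0, 0, 0, 0, 0, 0;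
       0, 0, 0, 1, 0, 0, 0, 0, 0, 0;
       0, 0, 0, 0, 1, 0, 0, 0, 0, 0;
       0, 0, 0, 0, 0, 1, 0, 0, 0, 0;
       0, 0, 0, 0, 0, 0, 1, 0, 0, 0;
       0, 0, 0, 0, 0, 0, 0, 1, 0, 0;
       0, 0, 0, 0, 0, 0, 0, 0, 1, 0;
       1, -1, 0, 0, 0, 0, 0, 0, 0, 0;
       0, 1, 3, 2, 4, 6, 5, 4, 3, 2], ?_⟩
  decide +kernel
end

section
/- There exists a 9×9 integer matrix M with |det M| = 3 such that M·C'·Mᵀ = C, where C' is the block Cartan matrix of E₇ ⊕ A₂ and C is the block Cartan matrix of A₅ ⊕ A₂ ⊕ A₂. Equivalently, the root lattice A₅ + 2A₂ embeds as a sublattice of index 3 into the root lattice E₇ + A₂, realizing E₇ + A₂ as an even integral overlattice of A₅ + 2A₂. -/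
open Matrix

/-- Generators of a sublattice `A₅ + 2A₂` of `E₇ + A₂`, obtained from the extended diagram of `E₇`
by deleting the node `2`, which has mark `3`; the added node, minus the highest root, is row `6`.
The columns are the simple roots of `E₇ + A₂` in the order `0, 3, 4, 5, 6, 1, 2, 7, 8`. -/
def sublatticeBasis : Matrix (Fin 9) (Fin 9) ℤ :=
  !![ 1,  0,  0,  0,  0,  0,  0,  0,  0;
      0,  1,  0,  0,  0,  0,  0,  0,  0;
      0,  0,  1,  0,  0,  0,  0,  0,  0;
      0,  0,  0,  1,  0,  0,  0,  0,  0;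
      0,  0,  0,  0,  1,  0,  0,  0,  0;
      0,  0,  0,  0,  0,  1,  0,  0,  0;
     -2, -4, -3, -2, -1, -2, -3,  0,  0;
      0,  0,  0,  0,  0,  0,  0,  1,  0;
      0,  0,  0,  0,  0,  0,  0,  0,  1]

theorem isLowerTriangular_sublatticeBasis : sublatticeBasis.IsLowerTriangular := by
  have h (i j : Fin 9) (hij : i < j) : sublatticeBasis i j = 0 := by
    rw [← Int.natAbs_eq_zero]
    decide +revert
  exact fun i j => h i j

theorem det_sublatticeBasis : sublatticeBasis.det = -3 := by
  rw [det_of_isLowerTriangular _ isLowerTriangular_sublatticeBasis]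
  decide +kernel

/-- The position of each simple root of `E₇ + A₂` among the columns of `sublatticeBasis`. -/
def columnPerm : Equiv.Perm (Fin 9) where
  toFun := ![0, 5, 6, 1, 2, 3, 4, 7, 8]
  invFun := ![0, 3, 4, 5, 6, 1, 2, 7, 8]
  left_inv := by decide
  right_inv := by decide

/-- The root lattice `A₅ + 2A₂` embeds with index `3` into the root lattice `E₇ + A₂`. -/
theorem overlattice_A5_2A2_in_E7_A2 :
    ∃ M : Matrix (Fin 9) (Fin 9) ℤ,
      M.det.natAbs = 3 ∧
      M * blockSum (cartanE 7) (cartanA 2) * M.transpose =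
        blockSum (cartanA 5) (blockSum (cartanA 2) (cartanA 2)) := by
  refine ⟨sublatticeBasis.submatrix id columnPerm, ?_, by decide +kernel⟩
  simp [det_permute', Int.natAbs_mul, det_sublatticeBasis]
end

section
/- There exists a 10×10 integer matrix M such that M·G₀·Mᵀ equals the block-diagonal matrix diag(10) ⊕ (−C_{A₉}), where C_{A₉} is the Cartan matrix of A₉. Equivalently, the rank-10 lattice ℤH ⊥ A₉ with H² = 10 and A₉ negative definite embeds as a finite-index sublattice (necessarily of index 10) into the even unimodular lattice U + E₈ of signature (1,9). -/
open Matrix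

/-- The rows after the first are the simple roots of `U + E₈`, seen as the root lattice of the
diagram `T₂,₃,₇`, other than the short arm; they form a chain ending with the affine node `e - θ`
and the hyperbolic node `f - e`. The first row is the fundamental weight of the short arm. -/
def embeddingMatrixH10A9 : Matrix (Fin 10) (Fin 10) ℤ :=
  !![-3, -3, 8, 5, 10, 15, 12, 9, 6, 3;
     0, 0, 0, 1, 0, 0, 0, 0, 0, 0;
     0, 0, 0, 0, 1, 0, 0, 0, 0, 0;
     0, 0, 0, 0, 0, 1, 0, 0, 0, 0;
     0, 0, 0, 0, 0, 0, 1, 0, 0, 0;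
     0, 0, 0, 0, 0, 0, 0, 1, 0, 0;
     0, 0, 0, 0, 0, 0, 0, 0, 1, 0;
     0, 0, 0, 0, 0, 0, 0, 0, 0, 1;
     1, 0, -3, -2, -4, -6, -5, -4, -3, -2;
     -1, 1, 0, 0, 0, 0, 0, 0, 0, 0]

/-- The lattice `ℤH ⊥ A₉` with `H² = 10` embeds with finite index into `U + E₈`. -/
theorem embedding_H10_A9 :
    ∃ M : Matrix (Fin 10) (Fin 10) ℤ,
      M * gramUE8 * M.transpose = blockSum !![(10 : ℤ)] (-(cartanA 9)) := by
  exact ⟨embeddingMatrixH10A9, by decide +kernel⟩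
end

section
/- There exists a 10×10 integer matrix M such that M·G₀·Mᵀ equals the block-diagonal matrix diag(4) ⊕ (−C_{D₉}), where C_{D₉} is the Cartan matrix of D₉. Equivalently, the rank-10 lattice ℤH ⊥ D₉ with H² = 4 and D₉ negative definite embeds as a finite-index sublattice (necessarily of index 4) into the even unimodular lattice U + E₈ of signature (1,9). -/
open Matrix

/-- The lattice `ℤH ⊥ D₉` with `H² = 4` embeds with finite index into `U + E₈`. -/
theorem embedding_H4_D9 :
    ∃ M : Matrix (Fin 10) (Fin 10) ℤ,
      M * gramUE8 * M.transpose = blockSum !![(4 : ℤ)] (-(cartanD 9)) := by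
  -- The nodes of `D₉` are simple roots of `U + E₈` (the hyperbolic diagram `E₁₀`), minus one node;
  -- the first row spans their orthogonal complement.
  refine ⟨!![2, 2, -5, -4, -7, -10, -8, -6, -4, -2;
      1, -1, 0, 0, 0, 0, 0, 0, 0, 0;
      0, 1, -3, -2, -4, -6, -5, -4, -3, -2;
      0, 0, 0, 0, 0, 0, 0, 0, 0, 1;
      0, 0, 0, 0, 0, 0, 0, 0, 1, 0;
      0, 0, 0, 0, 0, 0, 0, 1, 0, 0;
      0, 0, 0, 0, 0, 0, 1, 0, 0, 0;
      0, 0, 0, 0, 0, 1, 0, 0, 0, 0;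
      0, 0, 0, 0, 1, 0, 0, 0, 0, 0;
      0, 0, 1, 0, 0, 0, 0, 0, 0, 0], ?_⟩
  decide +kernel
end

section
/- There exists a 10×10 integer matrix M such that M·G₀·Mᵀ equals the block-diagonal matrix diag(12) ⊕ (−C), where C is the block Cartan matrix of E₆ ⊕ A₃. Equivalently, the rank-10 lattice ℤH ⊥ (E₆ + A₃) with H² = 12 and E₆ + A₃ negative definite embeds as a finite-index sublattice (necessarily of index 12) into the even unimodular lattice U + E₈ of signature (1,9). -/
open Matrix

/-- The lattice `ℤH ⊥ (E₆ + A₃)` with `H² = 12` embeds with finite index into `U + E₈`. -/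
theorem embedding_H12_E6_A3 :
    ∃ M : Matrix (Fin 10) (Fin 10) ℤ,
      M * gramUE8 * M.transpose =
        blockSum !![(12 : ℤ)] (-(blockSum (cartanE 6) (cartanA 3))) := by
  -- The Dynkin diagram of `U + E₈` is `T₂,₃,₇`; deleting one node of its long arm leaves `E₆ + A₃`.
  refine ⟨!![3, 3, -6, -4, -8, -12, -10, -8, -6, -3;
      0, 0, 1, 0, 0, 0, 0, 0, 0, 0;
      0, 0, 0, 1, 0, 0, 0, 0, 0, 0;
      0, 0, 0, 0, 1, 0, 0, 0, 0, 0;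
      0, 0, 0, 0, 0, 1, 0, 0, 0, 0;
      0, 0, 0, 0, 0, 0, 1, 0, 0, 0;
      0, 0, 0, 0, 0, 0, 0, 1, 0, 0;
      0, 0, 0, 0, 0, 0, 0, 0, 0, 1;
      1, 0, -3, -2, -4, -6, -5, -4, -3, -2;
      -1, 1, 0, 0, 0, 0, 0, 0, 0, 0], ?_⟩
  decide +kernel
end

section
/- There exists a 10×10 integer matrix M such that M·G₀·Mᵀ equals the block-diagonal matrix diag(42) ⊕ (−C), where C is the block Cartan matrix of A₆ ⊕ A₂ ⊕ A₁. Equivalently, the rank-10 lattice ℤH ⊥ (A₆ + A₂ + A₁) with H² = 42 and A₆ + A₂ + A₁ negative definite embeds as a finite-index sublattice (necessarily of index 42) into the even unimodular lattice U + E₈ of signature (1,9). -/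
open Matrix

/-- The lattice `ℤH ⊥ (A₆ + A₂ + A₁)` with `H² = 42` embeds with finite index into `U + E₈`. -/
theorem embedding_H42_A6_A2_A1 :
    ∃ M : Matrix (Fin 10) (Fin 10) ℤ,
      M * gramUE8 * M.transpose =
        blockSum !![(42 : ℤ)] (-(blockSum (cartanA 6) (blockSum (cartanA 2) (cartanA 1)))) := by
  -- The rows are the fundamental weight of the trivalent node of `T(2,3,7)`, followed by the
  -- simple roots on the three arms left when that node is deleted.
  refine ⟨!![6, 6, -15, -10, -20, -30, -24, -18, -12, -6;
             0, 0, 0, 0, 0, 0, 1, 0, 0, 0;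
             0, 0, 0, 0, 0, 0, 0, 1, 0, 0;
             0, 0, 0, 0, 0, 0, 0, 0, 1, 0;
             0, 0, 0, 0, 0, 0, 0, 0, 0, 1;
             1, 0, -3, -2, -4, -6, -5, -4, -3, -2;
             -1, 1, 0, 0, 0, 0, 0, 0, 0, 0;
             0, 0, 0, 1, 0, 0, 0, 0, 0, 0;
             0, 0, 0, 0, 1, 0, 0, 0, 0, 0;
             0, 0, 1, 0, 0, 0, 0, 0, 0, 0], ?_⟩
  decide +kernel
end

section
/- There exists a 10×10 integer matrix M such that M·G₀·Mᵀ equals the block-diagonal matrix diag(20) ⊕ (−C), where C is the block Cartan matrix of D₅ ⊕ A₄. Equivalently, the rank-10 lattice ℤH ⊥ (D₅ + A₄) with H² = 20 and D₅ + A₄ negative definite embeds as a finite-index sublattice (necessarily of index 20) into the even unimodular lattice U + E₈ of signature (1,9). -/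
open Matrix

/-- The lattice `ℤH ⊥ (D₅ + A₄)` with `H² = 20` embeds with finite index into `U + E₈`. -/
theorem embedding_H20_D5_A4 :
    ∃ M : Matrix (Fin 10) (Fin 10) ℤ,
      M * gramUE8 * M.transpose =
        blockSum !![(20 : ℤ)] (-(blockSum (cartanD 5) (cartanA 4))) := by
  refine ⟨!![4, 4, -9, -6, -12, -18, -15, -12, -8, -4;
             0, 0, 0, 1, 0, 0, 0, 0, 0, 0;
             0, 0, 0, 0, 1, 0, 0, 0, 0, 0;
             0, 0, 0, 0, 0, 1, 0, 0, 0, 0;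
             0, 0, 1, 0, 0, 0, 0, 0, 0, 0;
             0, 0, 0, 0, 0, 0, 1, 0, 0, 0;
             0, 0, 0, 0, 0, 0, 0, 0, 1, 0;
             0, 0, 0, 0, 0, 0, 0, 0, 0, 1;
             1, 0, -3, -2, -4, -6, -5, -4, -3, -2;
             -1, 1, 0, 0, 0, 0, 0, 0, 0, 0], ?_⟩
  decide +kernel
end

section
/- There exists a 9×9 integer matrix M with |det M| = 5 such that M·C'·Mᵀ = C, where C' is the block Cartan matrix of E₈ ⊕ A₁ and C is the block Cartan matrix of A₄ ⊕ A₄ ⊕ A₁. Equivalently, the root lattice 2A₄ + A₁ embeds as a sublattice of index 5 into the root lattice E₈ + A₁, realizing E₈ + A₁ as an even integral overlattice of 2A₄ + A₁. -/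
open Matrix

/-- Embedding matrix of `2A₄ + A₁` into `E₈ + A₁`, obtained from the extended Dynkin diagram of `E₈`
by deleting the node with coefficient `5` in the highest root. -/
def embedding2A4A1 : Matrix (Fin 9) (Fin 9) ℤ :=
  !![0, 1, 0, 0, 0, 0, 0, 0, 0;
     0, 0, 1, 0, 0, 0, 0, 0, 0;
     0, 0, 0, 1, 0, 0, 0, 0, 0;
     1, 0, 0, 0, 0, 0, 0, 0, 0;
     0, 0, 0, 0, 0, 1, 0, 0, 0;
     0, 0, 0, 0, 0, 0, 1, 0, 0;
     0, 0, 0, 0, 0, 0, 0, 1, 0;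
     -3, -2, -4, -6, -5, -4, -3, -2, 0;
     0, 0, 0, 0, 0, 0, 0, 0, 1]

/-- The column permutation that makes `embedding2A4A1` lower triangular. -/
def embeddingPerm : Equiv.Perm (Fin 9) where
  toFun := ![1, 2, 3, 0, 5, 6, 7, 4, 8]
  invFun := ![3, 0, 1, 2, 7, 4, 5, 6, 8]
  left_inv := by decide
  right_inv := by decide

theorem isLowerTriangular_embedding2A4A1 :
    (embedding2A4A1.submatrix id embeddingPerm).IsLowerTriangular := by
  have h : ∀ i j : Fin 9, i < j → embedding2A4A1 i (embeddingPerm j) = (0 : ℤ) := by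
    decide +kernel
  exact fun i j hij => h i j hij

theorem prod_diag_embedding2A4A1 :
    ∏ i, embedding2A4A1.submatrix id embeddingPerm i i = -5 := by
  simp only [submatrix_apply]
  decide +kernel

theorem natAbs_det_submatrix_perm {n : Type*} [DecidableEq n] [Fintype n] (σ : Equiv.Perm n)
    (M : Matrix n n ℤ) : (M.submatrix id σ).det.natAbs = M.det.natAbs := by
  rw [Matrix.det_permute', Int.natAbs_mul, Int.cast_id, Int.units_natAbs, one_mul]

theorem natAbs_det_embedding2A4A1 : embedding2A4A1.det.natAbs = 5 := by
  rw [← natAbs_det_submatrix_perm embeddingPerm,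
    Matrix.det_of_isLowerTriangular _ isLowerTriangular_embedding2A4A1,
    prod_diag_embedding2A4A1]
  rfl

/-- The root lattice `2A₄ + A₁` embeds with index `5` into the root lattice `E₈ + A₁`. -/
theorem overlattice_2A4_A1_in_E8_A1 :
    ∃ M : Matrix (Fin 9) (Fin 9) ℤ,
      M.det.natAbs = 5 ∧
      M * blockSum (cartanE 8) (cartanA 1) * M.transpose =
        blockSum (cartanA 4) (blockSum (cartanA 4) (cartanA 1)) := by
  refine ⟨embedding2A4A1, natAbs_det_embedding2A4A1, ?_⟩
  decide +kernel
end

section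
/- There exists a 9×9 integer matrix M with |det M| = 4 such that M·C'·Mᵀ = C, where C' is the Cartan matrix of D₉ and C is the block Cartan matrix of A₃ ⊕ A₃ ⊕ A₃. Equivalently, the root lattice 3A₃ embeds as a sublattice of index 4 into the root lattice D₉, realizing D₉ as an even integral overlattice of 3A₃. -/
open Matrix

/-- Coordinates of the simple roots of `3A₃` in the simple roots of `D₉`. With `e₀, …, e₈` the
standard basis of `ℤ⁹`, the three chains are `eₖ - eₖ₊₁`, `eₖ₊₁ - eₖ₊₂`, `-eₖ - eₖ₊₁`
for `k = 0, 3, 6`. -/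
def embeddingThreeA3D9 : Matrix (Fin 9) (Fin 9) ℤ :=
  !![ 1,  0,  0,  0,  0,  0,  0,  0,  0;
      0,  1,  0,  0,  0,  0,  0,  0,  0;
     -1, -2, -2, -2, -2, -2, -2, -1, -1;
      0,  0,  0,  1,  0,  0,  0,  0,  0;
      0,  0,  0,  0,  1,  0,  0,  0,  0;
      0,  0,  0, -1, -2, -2, -2, -1, -1;
      0,  0,  0,  0,  0,  0,  1,  0,  0;
      0,  0,  0,  0,  0,  0,  0,  1,  0;
      0,  0,  0,  0,  0,  0, -1, -1, -1]

/-- The unipotent lower triangular factor of `embeddingThreeA3D9`. -/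
def lowerFactorThreeA3D9 : Matrix (Fin 9) (Fin 9) ℤ :=
  !![ 1,  0,  0,  0,  0,  0,  0,  0,  0;
      0,  1,  0,  0,  0,  0,  0,  0,  0;
     -1, -2,  1,  0,  0,  0,  0,  0,  0;
      0,  0,  0,  1,  0,  0,  0,  0,  0;
      0,  0,  0,  0,  1,  0,  0,  0,  0;
      0,  0,  0, -1, -2,  1,  0,  0,  0;
      0,  0,  0,  0,  0,  0,  1,  0,  0;
      0,  0,  0,  0,  0,  0,  0,  1,  0;
      0,  0,  0,  0,  0,  0, -1, -1,  1]

/-- The upper triangular factor of `embeddingThreeA3D9`. -/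
def upperFactorThreeA3D9 : Matrix (Fin 9) (Fin 9) ℤ :=
  !![ 1,  0,  0,  0,  0,  0,  0,  0,  0;
      0,  1,  0,  0,  0,  0,  0,  0,  0;
      0,  0, -2, -2, -2, -2, -2, -1, -1;
      0,  0,  0,  1,  0,  0,  0,  0,  0;
      0,  0,  0,  0,  1,  0,  0,  0,  0;
      0,  0,  0,  0,  0, -2, -2, -1, -1;
      0,  0,  0,  0,  0,  0,  1,  0,  0;
      0,  0,  0,  0,  0,  0,  0,  1,  0;
      0,  0,  0,  0,  0,  0,  0,  0, -1]

theorem det_lowerFactorThreeA3D9 : lowerFactorThreeA3D9.det = 1 := by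
  have h : ∀ p : Fin 9 × Fin 9, p.1 < p.2 → lowerFactorThreeA3D9 p.1 p.2 = 0 := by decide
  rw [Matrix.det_of_isLowerTriangular _ fun i j hij => h (i, j) hij]
  decide

theorem det_upperFactorThreeA3D9 : upperFactorThreeA3D9.det = -4 := by
  have h : ∀ p : Fin 9 × Fin 9, p.2 < p.1 → upperFactorThreeA3D9 p.1 p.2 = 0 := by decide
  rw [Matrix.det_of_isUpperTriangular fun i j hij => h (i, j) hij]
  decide

theorem embeddingThreeA3D9_eq_mul :
    embeddingThreeA3D9 = lowerFactorThreeA3D9 * upperFactorThreeA3D9 := by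
  decide +kernel

theorem det_embeddingThreeA3D9 : embeddingThreeA3D9.det = -4 := by
  rw [embeddingThreeA3D9_eq_mul, Matrix.det_mul, det_lowerFactorThreeA3D9,
    det_upperFactorThreeA3D9, one_mul]

/-- The root lattice `3A₃` embeds with index `4` into the root lattice `D₉`. -/
theorem overlattice_3A3_in_D9 :
    ∃ M : Matrix (Fin 9) (Fin 9) ℤ,
      M.det.natAbs = 4 ∧
      M * cartanD 9 * M.transpose =
        blockSum (cartanA 3) (blockSum (cartanA 3) (cartanA 3)) := by
  refine ⟨embeddingThreeA3D9, ?_, ?_⟩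
  · rw [det_embeddingThreeA3D9]
    rfl
  · decide +kernel
end

section
/- There exists a 9×9 integer matrix M with |det M| = 3 such that M·C'·Mᵀ = C, where C' is the block Cartan matrix of A₃ ⊕ E₆ and C is the block Cartan matrix of A₃ ⊕ A₂ ⊕ A₂ ⊕ A₂. Equivalently, the root lattice A₃ + 3A₂ embeds as a sublattice of index 3 into the root lattice A₃ + E₆, realizing A₃ + E₆ as an even integral overlattice of A₃ + 3A₂. -/
open Matrix

/-- In `A₃ ⊕ E₆`: the simple roots of `A₃`, followed by the three copies of `A₂` obtained from
the extended Dynkin diagram of `E₆` by deleting its branch vertex. The last row is the negative of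
the highest root of `E₆`. -/
def rowsA3AddThreeA2 : Matrix (Fin 9) (Fin 9) ℤ :=
  !![1, 0, 0, 0, 0, 0, 0, 0, 0;
     0, 1, 0, 0, 0, 0, 0, 0, 0;
     0, 0, 1, 0, 0, 0, 0, 0, 0;
     0, 0, 0, 0, 1, 0, 0, 0, 0;
     0, 0, 0, 0, 0, 1, 0, 0, 0;
     0, 0, 0, 0, 0, 0, 0, 1, 0;
     0, 0, 0, 0, 0, 0, 0, 0, 1;
     0, 0, 0, 1, 0, 0, 0, 0, 0;
     0, 0, 0, -2, -1, -2, -3, -2, -1]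

theorem natAbs_det_rowsA3AddThreeA2 : rowsA3AddThreeA2.det.natAbs = 3 := by
  let σ : Fin 9 ≃ Fin 9 :=
    ⟨![0, 1, 2, 7, 3, 4, 5, 6, 8], ![0, 1, 2, 4, 5, 6, 7, 3, 8], by decide, by decide⟩
  let τ : Fin 9 ≃ Fin 9 :=
    ⟨![0, 1, 2, 3, 4, 5, 7, 8, 6], ![0, 1, 2, 3, 4, 5, 8, 6, 7], by decide, by decide⟩
  have triangular : ∀ i j : Fin 9, i < j → rowsA3AddThreeA2 (σ i) (τ j) = 0 := by decide +kernel
  have diagonal : ∏ i, rowsA3AddThreeA2 (σ i) (τ i) = -3 := by decide +kernel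
  zify
  rw [← abs_det_submatrix_equiv_equiv σ τ,
    det_of_isLowerTriangular (rowsA3AddThreeA2.submatrix σ τ) fun i j h => triangular i j h]
  simp only [submatrix_apply, diagonal]
  rfl

theorem gram_rowsA3AddThreeA2 :
    rowsA3AddThreeA2 * blockSum (cartanA 3) (cartanE 6) * rowsA3AddThreeA2.transpose =
      blockSum (cartanA 3) (blockSum (cartanA 2) (blockSum (cartanA 2) (cartanA 2))) := by
  decide +kernel

/-- The root lattice `A₃ + 3A₂` embeds with index `3` into the root lattice `A₃ + E₆`. -/
theorem overlattice_A3_3A2_in_A3_E6 :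
    ∃ M : Matrix (Fin 9) (Fin 9) ℤ,
      M.det.natAbs = 3 ∧
      M * blockSum (cartanA 3) (cartanE 6) * M.transpose =
        blockSum (cartanA 3) (blockSum (cartanA 2) (blockSum (cartanA 2) (cartanA 2))) := by
  exact ⟨rowsA3AddThreeA2, natAbs_det_rowsA3AddThreeA2, gram_rowsA3AddThreeA2⟩
end
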